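/- arXiv:1402.2520 — 2 statements merged into one kernel-verified Lean document; each statement's English description precedes it below -/
import Mathlib

section
/- Let n, m, r be positive integers. For every f ∈ C[0,1], the r-th iterate of the composite Bernstein operator satisfies the uniform bound ‖(B̄_{n,m})^r(f) - S_{Δ_m}(f)‖_∞ ≤ (9/4)·ω₂(f; (1/(2m))·√((1 - 1/n)^r)). -/
open Set Finset

noncomputable section

/-- Second order modulus of smoothness of `f` on `[a,b]`. -/
def omega2 (a b : ℝ) (f : ℝ → ℝ) (δ : ℝ) : ℝ :=
  sSup {v | ∃ x h : ℝ, x - h ∈ Set.Icc a b ∧ x + h ∈ Set.Icc a b ∧ |h| ≤ δ ∧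
    v = |f (x - h) - 2 * f x + f (x + h)|}

/-- The Bernstein polynomial of degree `n` associated to `f` on the
subinterval `[(k-1)/m, k/m]`. -/
def bernsteinPiece (n m k : ℕ) (f : ℝ → ℝ) (x : ℝ) : ℝ :=
  (m : ℝ) ^ n * ∑ i ∈ Finset.range (n + 1),
    (n.choose i : ℝ) * (x - ((k : ℝ) - 1) / (m : ℝ)) ^ i * ((k : ℝ) / (m : ℝ) - x) ^ (n - i) *
      f (((k : ℝ) * n - n + i) / ((m : ℝ) * n))

/-- The index `k` (with `1 ≤ k ≤ m`) such that `x` belongs to the piece `[(k-1)/m, k/m]`. -/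
def pieceIdx (m : ℕ) (x : ℝ) : ℕ := min m (⌊(m : ℝ) * x⌋.toNat + 1)

/-- The composite Bernstein operator `B̄_{n,m}`. -/
def compBernstein (n m : ℕ) (f : ℝ → ℝ) : ℝ → ℝ := fun x =>
  bernsteinPiece n m (pieceIdx m x) f x

/-- The piecewise linear interpolation operator at the nodes `k/m`, `k = 0, …, m`. -/
def pwLinear (m : ℕ) (f : ℝ → ℝ) : ℝ → ℝ := fun x =>
  (m : ℝ) * (((pieceIdx m x : ℝ) / (m : ℝ) - x) * f (((pieceIdx m x : ℝ) - 1) / (m : ℝ)) +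
    (x - ((pieceIdx m x : ℝ) - 1) / (m : ℝ)) * f ((pieceIdx m x : ℝ) / (m : ℝ)))

lemma le_add_mul_of_second_difference {g : ℝ → ℝ} (hg : ContinuousOn g (Set.Icc 0 1))
    (h0 : g 0 = 0) (h1 : g 1 = 0) {W H c : ℝ} (hH : 0 < H) (hc : 0 ≤ c)
    (hcW : W < 2 * c * H ^ 2)
    (hd : ∀ x h : ℝ, 0 ≤ x - h → x + h ≤ 1 → 0 ≤ h → h ≤ H →
      -W ≤ g (x - h) - 2 * g x + g (x + h)) :
    ∀ y ∈ Set.Icc (0 : ℝ) 1, g y ≤ W + c * (y * (1 - y)) := by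
  have hcont : ContinuousOn (fun y => g y - c * (y * (1 - y))) (Set.Icc 0 1) :=
    hg.sub (by fun_prop)
  obtain ⟨p, ⟨hp0, hp1⟩, hmax⟩ :=
    isCompact_Icc.exists_isMaxOn (Set.nonempty_Icc.2 zero_le_one) hcont
  have hM : ∀ y, 0 ≤ y → y ≤ 1 → g y - c * (y * (1 - y)) ≤ g p - c * (p * (1 - p)) :=
    fun y hy0 hy1 => hmax ⟨hy0, hy1⟩
  suffices hp : g p - c * (p * (1 - p)) ≤ W by
    rintro y ⟨hy0, hy1⟩
    linarith [hM y hy0 hy1]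
  rcases le_total p (1 / 2) with hp | hp
  · rcases le_total p H with hpH | hpH
    · have e1 := hd p p (by linarith) (by linarith) hp0 hpH
      have e2 := hM (p + p) (by linarith) (by linarith)
      rw [sub_self, h0] at e1
      nlinarith [mul_nonneg hc (sq_nonneg p)]
    · have e1 := hd p H (by linarith) (by linarith) hH.le le_rfl
      have e2 := hM (p + H) (by linarith) (by linarith)
      have e3 := hM (p - H) (by linarith) (by linarith)
      nlinarith
  · rcases le_total (1 - p) H with hpH | hpH
    · have e1 := hd p (1 - p) (by linarith) (by linarith) (by linarith) hpH
      have e2 := hM (p - (1 - p)) (by linarith) (by linarith)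
      rw [add_sub_cancel, h1] at e1
      nlinarith [mul_nonneg hc (sq_nonneg (1 - p))]
    · have e1 := hd p H (by linarith) (by linarith) hH.le le_rfl
      have e2 := hM (p + H) (by linarith) (by linarith)
      have e3 := hM (p - H) (by linarith) (by linarith)
      nlinarith

/-- The Bernstein basis function of degree `n` and index `i`, evaluated at `y`. -/
def bernsteinWeight (n i : ℕ) (y : ℝ) : ℝ := (n.choose i : ℝ) * y ^ i * (1 - y) ^ (n - i)

lemma bernsteinWeight_eq_eval (n i : ℕ) (y : ℝ) :
    bernsteinWeight n i y = (bernsteinPolynomial ℝ n i).eval y := by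
  simp [bernsteinWeight, bernsteinPolynomial]

lemma bernsteinWeight_nonneg (n i : ℕ) {y : ℝ} (h0 : 0 ≤ y) (h1 : y ≤ 1) :
    0 ≤ bernsteinWeight n i y := by
  have := sub_nonneg.2 h1
  unfold bernsteinWeight
  positivity

lemma sum_bernsteinWeight (n : ℕ) (y : ℝ) :
    ∑ i ∈ Finset.range (n + 1), bernsteinWeight n i y = 1 := by
  simpa [bernsteinWeight_eq_eval, Polynomial.eval_finsetSum] using
    congrArg (Polynomial.eval y) (bernsteinPolynomial.sum ℝ n)

lemma sum_bernsteinWeight_mul_index (n : ℕ) (y : ℝ) :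
    ∑ i ∈ Finset.range (n + 1), bernsteinWeight n i y * i = n * y := by
  simpa [bernsteinWeight_eq_eval, Polynomial.eval_finsetSum, mul_comm] using
    congrArg (Polynomial.eval y) (bernsteinPolynomial.sum_smul ℝ n)

lemma sum_bernsteinWeight_mul_index_sq (n : ℕ) (y : ℝ) :
    ∑ i ∈ Finset.range (n + 1), bernsteinWeight n i y * ((i : ℝ) * i) =
      n * (n - 1) * y ^ 2 + n * y := by
  have h := congrArg (Polynomial.eval y) (bernsteinPolynomial.sum_mul_smul ℝ n)
  simp only [Polynomial.eval_finsetSum, nsmul_eq_mul, Polynomial.eval_mul,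
    Polynomial.eval_natCast, Polynomial.eval_pow, Polynomial.eval_X,
    ← bernsteinWeight_eq_eval] at h
  have hpred : ∀ i : ℕ, ((i * (i - 1) : ℕ) : ℝ) = i * i - i := by
    intro i
    cases i with
    | zero => simp
    | succ i => push_cast [Nat.add_sub_cancel]; ring
  simp only [hpred, sub_mul, Finset.sum_sub_distrib] at h
  have h' := sum_bernsteinWeight_mul_index n y
  simp only [mul_comm (bernsteinWeight n _ y)] at h' ⊢
  linarith

lemma abs_sum_bernsteinWeight_sub_le {n : ℕ} (hn : 0 < n) {y : ℝ} (h0 : 0 ≤ y) (h1 : y ≤ 1)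
    (G : ℕ → ℝ) (α β A C : ℝ)
    (hG : ∀ i ≤ n, |G i - ((1 - (i : ℝ) / n) * α + (i : ℝ) / n * β)| ≤
      A + C * ((i : ℝ) / n * (1 - (i : ℝ) / n))) :
    |∑ i ∈ Finset.range (n + 1), bernsteinWeight n i y * G i - ((1 - y) * α + y * β)| ≤
      A + C * (1 - 1 / n) * (y * (1 - y)) := by
  have hn' : (n : ℝ) ≠ 0 := by positivity
  have s0 := sum_bernsteinWeight n y
  have s1 := sum_bernsteinWeight_mul_index n y
  have s2 := sum_bernsteinWeight_mul_index_sq n y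
  have hquad : ∀ p q r : ℝ, ∑ i ∈ Finset.range (n + 1), bernsteinWeight n i y *
      (p + q * i + r * ((i : ℝ) * i)) = p + q * (n * y) + r * (n * (n - 1) * y ^ 2 + n * y) := by
    intro p q r
    rw [← s2, ← s1, Finset.mul_sum, Finset.mul_sum]
    nth_rewrite 2 [← mul_one p]
    rw [← s0, Finset.mul_sum, ← Finset.sum_add_distrib, ← Finset.sum_add_distrib]
    exact Finset.sum_congr rfl fun i _ => by ring
  have hlin : ∑ i ∈ Finset.range (n + 1), bernsteinWeight n i y *
      ((1 - (i : ℝ) / n) * α + (i : ℝ) / n * β) = (1 - y) * α + y * β := by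
    have := hquad α ((β - α) / n) 0
    rw [show (1 - y) * α + y * β = α + (β - α) / n * (n * y) +
      0 * (n * (n - 1) * y ^ 2 + n * y) by field_simp; ring, ← this]
    exact Finset.sum_congr rfl fun i _ => by field_simp; ring
  have hpar : ∑ i ∈ Finset.range (n + 1), bernsteinWeight n i y *
      (A + C * ((i : ℝ) / n * (1 - (i : ℝ) / n))) = A + C * (1 - 1 / n) * (y * (1 - y)) := by
    have := hquad A (C / n) (-C / (n * n))
    rw [show A + C * (1 - 1 / n) * (y * (1 - y)) = A + C / n * (n * y) +
      -C / (n * n) * (n * (n - 1) * y ^ 2 + n * y) by field_simp; ring, ← this]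
    exact Finset.sum_congr rfl fun i _ => by field_simp; ring
  rw [← hlin, ← hpar, ← Finset.sum_sub_distrib]
  refine (Finset.abs_sum_le_sum_abs _ _).trans (Finset.sum_le_sum fun i hi => ?_)
  have hw := bernsteinWeight_nonneg n i h0 h1
  rw [← mul_sub, abs_mul, abs_of_nonneg hw]
  exact mul_le_mul_of_nonneg_left (hG i (by simpa [Nat.lt_succ_iff] using hi)) hw

lemma bernsteinPiece_succ {n m : ℕ} (hn : 0 < n) (hm : 0 < m) (j : ℕ) (f : ℝ → ℝ) (y : ℝ) :
    bernsteinPiece n m (j + 1) f ((j + y) / m) =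
      ∑ i ∈ Finset.range (n + 1), bernsteinWeight n i y * f ((j + (i : ℝ) / n) / m) := by
  have hn' : (n : ℝ) ≠ 0 := by positivity
  have hm' : (m : ℝ) ≠ 0 := by positivity
  rw [bernsteinPiece, Finset.mul_sum]
  refine Finset.sum_congr rfl fun i hi => ?_
  have hi : i ≤ n := by simpa [Nat.lt_succ_iff] using hi
  have e1 : ((j : ℝ) + y) / m - (((j + 1 : ℕ) : ℝ) - 1) / m = y / m := by
    push_cast; field_simp; ring
  have e2 : (((j + 1 : ℕ) : ℝ)) / m - ((j : ℝ) + y) / m = (1 - y) / m := by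
    push_cast; field_simp; ring
  have e3 : (((j + 1 : ℕ) : ℝ) * n - n + i) / ((m : ℝ) * n) = (j + (i : ℝ) / n) / m := by
    push_cast; field_simp; ring
  have e4 : (m : ℝ) ^ n = m ^ i * m ^ (n - i) := by rw [← pow_add, Nat.add_sub_cancel' hi]
  rw [e1, e2, e3, e4, div_pow, div_pow, bernsteinWeight]
  field_simp

lemma pieceIdx_of_lt_one {m j : ℕ} (hj : j < m) {y : ℝ} (h0 : 0 ≤ y) (h1 : y < 1) :
    pieceIdx m ((j + y) / m) = j + 1 := by
  have hm' : (m : ℝ) ≠ 0 := by exact_mod_cast (by omega : m ≠ 0)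
  have hfloor : ⌊(m : ℝ) * ((j + y) / m)⌋ = (j : ℤ) := by
    rw [mul_div_cancel₀ _ hm', Int.floor_eq_iff]
    push_cast
    constructor <;> linarith
  rw [pieceIdx, hfloor, Int.toNat_natCast]
  omega

/-- The point `1` of the last piece belongs to that piece. -/
lemma pieceIdx_one (m : ℕ) : pieceIdx m 1 = m := by
  simp [pieceIdx]

lemma sum_bernsteinWeight_zero_mul (n : ℕ) (G : ℕ → ℝ) :
    ∑ i ∈ Finset.range (n + 1), bernsteinWeight n i 0 * G i = G 0 := by
  rw [Finset.sum_eq_single 0]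
  · simp [bernsteinWeight]
  · intro i _ hi
    simp [bernsteinWeight, hi]
  · simp

lemma sum_bernsteinWeight_one_mul (n : ℕ) (G : ℕ → ℝ) :
    ∑ i ∈ Finset.range (n + 1), bernsteinWeight n i 1 * G i = G n := by
  rw [Finset.sum_eq_single n]
  · simp [bernsteinWeight]
  · intro i hi hin
    have : n - i ≠ 0 := by
      have := Finset.mem_range.1 hi
      omega
    simp [bernsteinWeight, this]
  · simp

lemma compBernstein_apply {n m j : ℕ} (hn : 0 < n) (hj : j < m) (f : ℝ → ℝ) {y : ℝ}
    (h0 : 0 ≤ y) (h1 : y ≤ 1) :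
    compBernstein n m f ((j + y) / m) =
      ∑ i ∈ Finset.range (n + 1), bernsteinWeight n i y * f ((j + (i : ℝ) / n) / m) := by
  have hm : 0 < m := by omega
  have hn' : (n : ℝ) ≠ 0 := by positivity
  have hm' : (m : ℝ) ≠ 0 := by positivity
  rw [compBernstein]
  rcases h1.lt_or_eq with h1 | rfl
  · rw [pieceIdx_of_lt_one hj h0 h1, bernsteinPiece_succ hn hm]
  rcases (Nat.succ_le_of_lt hj).lt_or_eq with hj' | rfl
  · have e : ((j : ℝ) + 1) / m = (((j + 1 : ℕ) : ℝ) + 0) / m := by push_cast; ring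
    rw [e, pieceIdx_of_lt_one hj' le_rfl one_pos, bernsteinPiece_succ hn hm,
      sum_bernsteinWeight_zero_mul, sum_bernsteinWeight_one_mul]
    simp [hn']
  · have e : ((j : ℝ) + 1) / (j.succ : ℕ) = 1 := by
      rw [Nat.cast_succ] at hm' ⊢
      exact div_self hm'
    have := bernsteinPiece_succ hn hm j f 1
    rw [e] at this ⊢
    rw [pieceIdx_one, this]

lemma pwLinear_apply {m j : ℕ} (hj : j < m) (f : ℝ → ℝ) {y : ℝ} (h0 : 0 ≤ y) (h1 : y ≤ 1) :
    pwLinear m f ((j + y) / m) = (1 - y) * f (j / m) + y * f ((j + 1) / m) := by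
  have hm : 0 < m := by omega
  have h := compBernstein_apply (n := 1) one_pos hj f h0 h1
  have e : compBernstein 1 m f ((j + y) / m) = pwLinear m f ((j + y) / m) := by
    simp [compBernstein, bernsteinPiece, pwLinear, Finset.sum_range_succ]
  rw [← e, h]
  simp [Finset.sum_range_succ, bernsteinWeight]

lemma exists_piece {m : ℕ} (hm : 0 < m) {x : ℝ} (hx : x ∈ Set.Icc (0 : ℝ) 1) :
    ∃ j < m, ∃ y : ℝ, 0 ≤ y ∧ y ≤ 1 ∧ x = (j + y) / m := by
  have hm' : (0 : ℝ) < m := by positivity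
  rcases hx.2.lt_or_eq with h1 | rfl
  · have hmx : 0 ≤ (m : ℝ) * x := mul_nonneg hm'.le hx.1
    refine ⟨⌊(m : ℝ) * x⌋₊, ?_, m * x - ⌊(m : ℝ) * x⌋₊, ?_, ?_, ?_⟩
    · rw [Nat.floor_lt hmx]
      nlinarith
    · linarith [Nat.floor_le hmx]
    · linarith [Nat.lt_floor_add_one ((m : ℝ) * x)]
    · field_simp; ring
  · refine ⟨m - 1, by omega, 1, zero_le_one, le_rfl, ?_⟩
    rw [Nat.cast_sub (by omega)]
    field_simp
    simp

/-- A bound by a constant plus a multiple of the parabola on each piece improves by the factor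
`1 - 1 / n` in the parabola with each application of the composite Bernstein operator. -/
lemma abs_compBernstein_iterate_sub_le {n m : ℕ} (hn : 0 < n) {F f : ℝ → ℝ} {A C : ℝ}
    (hF : ∀ j < m, ∀ y : ℝ, 0 ≤ y → y ≤ 1 →
      |F ((j + y) / m) - ((1 - y) * f (j / m) + y * f ((j + 1) / m))| ≤ A + C * (y * (1 - y)))
    (r : ℕ) : ∀ j < m, ∀ y : ℝ, 0 ≤ y → y ≤ 1 →
      |(compBernstein n m)^[r] F ((j + y) / m) - ((1 - y) * f (j / m) + y * f ((j + 1) / m))| ≤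
        A + C * (1 - 1 / n) ^ r * (y * (1 - y)) := by
  induction r with
  | zero => simpa using hF
  | succ r ih =>
    intro j hj y h0 h1
    rw [Function.iterate_succ_apply', compBernstein_apply hn hj _ h0 h1, pow_succ, ← mul_assoc C]
    refine abs_sum_bernsteinWeight_sub_le hn h0 h1 _ _ _ _ _ fun i hi => ?_
    exact ih j hj _ (by positivity) (div_le_one_of_le₀ (by exact_mod_cast hi) (by positivity))

lemma omega2_nonneg (a b : ℝ) (f : ℝ → ℝ) (δ : ℝ) : 0 ≤ omega2 a b f δ :=
  Real.sSup_nonneg (by rintro _ ⟨x, h, -, -, -, rfl⟩; exact abs_nonneg _)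

lemma abs_second_difference_le_omega2 {a b : ℝ} {f : ℝ → ℝ} (hf : ContinuousOn f (Set.Icc a b))
    {x h δ : ℝ} (h1 : x - h ∈ Set.Icc a b) (h2 : x + h ∈ Set.Icc a b) (hδ : |h| ≤ δ) :
    |f (x - h) - 2 * f x + f (x + h)| ≤ omega2 a b f δ := by
  refine le_csSup ?_ ⟨x, h, h1, h2, hδ, rfl⟩
  obtain ⟨M, hM⟩ := isCompact_Icc.exists_bound_of_continuousOn hf
  refine ⟨4 * M, ?_⟩
  rintro _ ⟨x, h, h1, h2, -, rfl⟩
  have b0 := abs_le.1 (hM x ⟨by linarith [h1.1, h2.1], by linarith [h1.2, h2.2]⟩)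
  have b1 := abs_le.1 (hM _ h1)
  have b2 := abs_le.1 (hM _ h2)
  exact abs_le.2 ⟨by linarith, by linarith⟩

lemma abs_sub_interpolation_le {m j : ℕ} (hj : j < m) {f : ℝ → ℝ}
    (hf : ContinuousOn f (Set.Icc 0 1)) {W H c : ℝ} (hH : 0 < H) (hc : 0 ≤ c)
    (hW : omega2 0 1 f (H / m) ≤ W) (hcW : W < 2 * c * H ^ 2) {y : ℝ} (h0 : 0 ≤ y)
    (h1 : y ≤ 1) :
    |f ((j + y) / m) - ((1 - y) * f (j / m) + y * f ((j + 1) / m))| ≤ W + c * (y * (1 - y)) := by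
  have hm : (0 : ℝ) < m := by exact_mod_cast (by omega : 0 < m)
  have hjm : (j : ℝ) + 1 ≤ m := by exact_mod_cast hj
  have hmem : ∀ y : ℝ, 0 ≤ y → y ≤ 1 → ((j : ℝ) + y) / m ∈ Set.Icc (0 : ℝ) 1 :=
    fun y h0 h1 => ⟨by positivity, div_le_one_of_le₀ (by linarith) hm.le⟩
  set g : ℝ → ℝ := fun y =>
    f ((j + y) / m) - ((1 - y) * f (j / m) + y * f ((j + 1) / m)) with hg_def
  have hg : ContinuousOn g (Set.Icc 0 1) := by
    refine ContinuousOn.sub (hf.comp (by fun_prop) fun y hy => hmem y hy.1 hy.2) (by fun_prop)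
  have hd : ∀ x h : ℝ, 0 ≤ x - h → x + h ≤ 1 → 0 ≤ h → h ≤ H →
      |g (x - h) - 2 * g x + g (x + h)| ≤ W := by
    intro x h hx0 hx1 hh0 hhH
    refine le_trans (le_of_eq ?_) ((abs_second_difference_le_omega2 hf (x := (j + x) / m)
      (h := h / m) (δ := H / m) ?_ ?_ ?_).trans hW)
    · rw [← sub_div, ← add_div, add_sub_assoc, add_assoc]
      congr 1
      simp only [hg_def]
      ring
    · rw [← sub_div, add_sub_assoc]
      exact hmem _ hx0 (by linarith)
    · rw [← add_div, add_assoc]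
      exact hmem _ (by linarith) hx1
    · rw [abs_of_nonneg (by positivity)]
      gcongr
  have g0 : g 0 = 0 := by simp [hg_def]
  have g1 : g 1 = 0 := by simp [hg_def]
  refine abs_le'.2 ⟨?_, ?_⟩
  · exact le_add_mul_of_second_difference hg g0 g1 hH hc hcW
      (fun x h a b c d => (abs_le.1 (hd x h a b c d)).1) y ⟨h0, h1⟩
  · refine le_add_mul_of_second_difference (g := fun y => -g y) hg.neg (by simp [g0])
      (by simp [g1]) hH hc hcW (fun x h a b c d => ?_) y ⟨h0, h1⟩
    linarith [(abs_le.1 (hd x h a b c d)).2]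

theorem compBernstein_iterates_uniform
    (n m r : ℕ) (hn : 0 < n) (hm : 0 < m) (hr : 0 < r)
    (f : ℝ → ℝ) (hf : ContinuousOn f (Set.Icc 0 1)) :
    sSup {v | ∃ x ∈ Set.Icc (0 : ℝ) 1, v = |(compBernstein n m)^[r] f x - pwLinear m f x|} ≤
      9 / 4 * omega2 0 1 f (1 / (2 * (m : ℝ)) * Real.sqrt ((1 - 1 / (n : ℝ)) ^ r)) := by
  have hω := omega2_nonneg 0 1 f (1 / (2 * (m : ℝ)) * Real.sqrt ((1 - 1 / (n : ℝ)) ^ r))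
  refine Real.sSup_le ?_ (by positivity)
  rintro _ ⟨x, hx, rfl⟩
  obtain ⟨j, hj, y, h0, h1, rfl⟩ := exists_piece hm hx
  rw [pwLinear_apply hj f h0 h1]
  rcases (Nat.succ_le_of_lt hn).eq_or_lt with rfl | hn1
  · obtain ⟨r, rfl⟩ := Nat.exists_eq_succ_of_ne_zero hr.ne'
    have hbase : ∀ j < m, ∀ y : ℝ, 0 ≤ y → y ≤ 1 →
        |compBernstein 1 m f ((j + y) / m) - ((1 - y) * f (j / m) + y * f ((j + 1) / m))| ≤
          0 + 0 * (y * (1 - y)) := by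
      intro j hj y h0 h1
      rw [compBernstein_apply hn hj f h0 h1]
      simp [Finset.sum_range_succ, bernsteinWeight]
    have h := abs_compBernstein_iterate_sub_le hn hbase r j hj y h0 h1
    rw [zero_mul, zero_mul, add_zero] at h
    rw [Function.iterate_succ_apply]
    exact h.trans (by positivity)
  · have hm' : (0 : ℝ) < m := by positivity
    have hn1' : (1 : ℝ) < n := by exact_mod_cast hn1
    have hq : 0 < (1 - 1 / (n : ℝ)) ^ r := by
      have : 1 / (n : ℝ) < 1 := by rw [div_lt_one (by linarith)]; exact hn1'
      exact pow_pos (by linarith) r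
    set Q := (1 - 1 / (n : ℝ)) ^ r with hQ
    have hδ : 1 / (2 * (m : ℝ)) * Real.sqrt Q = Real.sqrt Q / 2 / m := by field_simp
    rw [hδ] at hω ⊢
    refine le_of_forall_pos_le_add fun ε hε => ?_
    set W := omega2 0 1 f (Real.sqrt Q / 2 / m) + ε * (4 / 9) with hW
    have hWpos : 0 < W := by positivity
    have hsq : (Real.sqrt Q / 2) ^ 2 = Q / 4 := by
      rw [div_pow, Real.sq_sqrt hq.le]; norm_num
    have hcW : W < 2 * (5 * W / Q) * (Real.sqrt Q / 2) ^ 2 := by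
      rw [hsq]
      field_simp
      linarith
    have h := abs_compBernstein_iterate_sub_le hn (fun j hj y h0 h1 =>
      abs_sub_interpolation_le hj hf (half_pos (Real.sqrt_pos.2 hq)) (by positivity)
        (by rw [hW]; linarith : _ ≤ W) hcW h0 h1) r j hj y h0 h1
    rw [← hQ, div_mul_cancel₀ _ hq.ne'] at h
    nlinarith [mul_nonneg hWpos.le (sq_nonneg (y - 1 / 2))]
end
end

section
/- Let n, m be fixed positive integers with n ≥ 2. For every f ∈ C[0,1], the iterates (B̄_{n,m})^r(f) converge uniformly on [0,1] to S_{Δ_m}(f) as r → ∞. -/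
open Set Finset

noncomputable section

theorem pieceIdx_spec {m : ℕ} (hm : 0 < m) {x : ℝ} (hx : x ∈ Set.Icc (0 : ℝ) 1) :
    1 ≤ pieceIdx m x ∧ pieceIdx m x ≤ m ∧ (pieceIdx m x : ℝ) - 1 ≤ m * x ∧
      (m : ℝ) * x ≤ pieceIdx m x := by
  have hm' : (0 : ℝ) < m := by exact_mod_cast hm
  have h0 : 0 ≤ (m : ℝ) * x := mul_nonneg hm'.le hx.1
  have h1 : (m : ℝ) * x ≤ m := by nlinarith [hx.2]
  have hfloor : (⌊(m : ℝ) * x⌋.toNat : ℝ) = (⌊(m : ℝ) * x⌋ : ℝ) := by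
    exact_mod_cast congrArg (Int.cast : ℤ → ℝ) (Int.toNat_of_nonneg (Int.floor_nonneg.2 h0))
  have hle := Int.floor_le ((m : ℝ) * x)
  have hlt := Int.lt_floor_add_one ((m : ℝ) * x)
  refine ⟨by unfold pieceIdx; omega, min_le_left _ _, ?_, ?_⟩
  · have : (pieceIdx m x : ℝ) ≤ ((⌊(m : ℝ) * x⌋.toNat + 1 : ℕ) : ℝ) :=
      Nat.cast_le.2 (min_le_right _ _)
    push_cast at this
    linarith
  · unfold pieceIdx
    push_cast
    exact le_min h1 (by linarith)

theorem pwLinear_eq_of_mem {m k : ℕ} (hm : 0 < m) (f : ℝ → ℝ) (hk : 1 ≤ k) (hkm : k ≤ m) {x : ℝ}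
    (h₁ : (k : ℝ) - 1 ≤ m * x) (h₂ : (m : ℝ) * x ≤ k) :
    pwLinear m f x = (k - m * x) * f (((k : ℝ) - 1) / m) + (m * x - (k - 1)) * f ((k : ℝ) / m) := by
  have hm' : (0 : ℝ) < m := by exact_mod_cast hm
  have hk' : (1 : ℝ) ≤ k := by exact_mod_cast hk
  have hkm' : (k : ℝ) ≤ m := by exact_mod_cast hkm
  have hx : x ∈ Set.Icc (0 : ℝ) 1 := ⟨by nlinarith, by nlinarith⟩
  obtain ⟨-, -, hp₁, hp₂⟩ := pieceIdx_spec hm hx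
  have hS : pwLinear m f x = (pieceIdx m x - m * x) * f (((pieceIdx m x : ℝ) - 1) / m) +
      (m * x - (pieceIdx m x - 1)) * f ((pieceIdx m x : ℝ) / m) := by
    unfold pwLinear
    field_simp
  rw [hS]
  generalize pieceIdx m x = p at *
  rcases lt_trichotomy p k with h | rfl | h
  · have h' : (p : ℝ) + 1 ≤ k := by exact_mod_cast h
    rw [show (m : ℝ) * x = p by linarith, show (k : ℝ) = p + 1 by linarith]
    simp
  · rfl
  · have h' : (k : ℝ) + 1 ≤ p := by exact_mod_cast h
    rw [show (m : ℝ) * x = k by linarith, show (p : ℝ) = k + 1 by linarith]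
    simp

theorem pwLinear_node {m j : ℕ} (hm : 0 < m) (f : ℝ → ℝ) (hj : j ≤ m) :
    pwLinear m f ((j : ℝ) / m) = f ((j : ℝ) / m) := by
  have hm' : (m : ℝ) ≠ 0 := by exact_mod_cast hm.ne'
  have hmj : (m : ℝ) * (j / m) = j := by field_simp
  rcases Nat.eq_zero_or_pos j with rfl | hj0
  · rw [pwLinear_eq_of_mem hm f le_rfl hm (by simp) (by simp)]
    simp
  · rw [pwLinear_eq_of_mem hm f hj0 hj (by linarith) (by linarith), hmj]
    simp

theorem bernsteinPiece_eq {n m k : ℕ} (hn : 0 < n) (hm : 0 < m) (f : ℝ → ℝ) (x : ℝ) :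
    bernsteinPiece n m k f x = ∑ i ∈ Finset.range (n + 1),
      (n.choose i : ℝ) * (m * x - (k - 1)) ^ i * (1 - (m * x - (k - 1))) ^ (n - i) *
        f ((k - 1 + i / n) / m) := by
  have hm' : (m : ℝ) ≠ 0 := by exact_mod_cast hm.ne'
  have hn' : (n : ℝ) ≠ 0 := by exact_mod_cast hn.ne'
  unfold bernsteinPiece
  rw [Finset.mul_sum]
  refine Finset.sum_congr rfl fun i hi => ?_
  have hi : i ≤ n := Nat.lt_succ_iff.1 (Finset.mem_range.1 hi)
  rw [show (m : ℝ) * x - (k - 1) = m * (x - (k - 1) / m) by field_simp,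
    show 1 - (m : ℝ) * (x - (k - 1) / m) = m * (k / m - x) by field_simp; ring,
    show ((k : ℝ) - 1 + i / n) / m = (k * n - n + i) / (m * n) by field_simp,
    mul_pow, mul_pow]
  nth_rewrite 1 [← Nat.add_sub_cancel' hi]
  rw [pow_add]
  ring

theorem sum_bernstein_weights (n : ℕ) (t : ℝ) :
    ∑ i ∈ Finset.range (n + 1), (n.choose i : ℝ) * t ^ i * (1 - t) ^ (n - i) = 1 := by
  simpa [bernsteinPolynomial, Polynomial.eval_finsetSum] using
    congrArg (Polynomial.eval t) (bernsteinPolynomial.sum ℝ n)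

theorem sum_mul_bernstein_weights (n : ℕ) (t : ℝ) :
    ∑ i ∈ Finset.range (n + 1), (i : ℝ) * ((n.choose i : ℝ) * t ^ i * (1 - t) ^ (n - i)) =
      n * t := by
  simpa [bernsteinPolynomial, Polynomial.eval_finsetSum] using
    congrArg (Polynomial.eval t) (bernsteinPolynomial.sum_smul ℝ n)

/-- If `e` is bounded by `M` at the nodes `i / n` and vanishes at the two extreme ones, then its
Bernstein polynomial is damped by the mass of the two extreme weights. -/
theorem abs_sum_bernstein_weights_le {n : ℕ} (hn : 0 < n) {t : ℝ} (ht : t ∈ Set.Icc (0 : ℝ) 1)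
    {e : ℕ → ℝ} {M : ℝ} (he : ∀ i ≤ n, |e i| ≤ M) (he₀ : e 0 = 0) (heₙ : e n = 0) :
    |∑ i ∈ Finset.range (n + 1), (n.choose i : ℝ) * t ^ i * (1 - t) ^ (n - i) * e i| ≤
      (1 - t ^ n - (1 - t) ^ n) * M := by
  obtain ⟨l, rfl⟩ : ∃ l, n = l + 1 := ⟨n - 1, by omega⟩
  have hsum := sum_bernstein_weights (l + 1) t
  rw [Finset.sum_range_succ, Finset.sum_range_succ'] at hsum ⊢
  simp only [he₀, heₙ, mul_zero, add_zero]
  have hs : ∑ i ∈ Finset.range l, ((l + 1).choose (i + 1) : ℝ) * t ^ (i + 1) *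
      (1 - t) ^ (l + 1 - (i + 1)) = 1 - t ^ (l + 1) - (1 - t) ^ (l + 1) := by
    simp at hsum ⊢
    linarith
  rw [← hs, Finset.sum_mul]
  refine (Finset.abs_sum_le_sum_abs _ _).trans (Finset.sum_le_sum fun i hi => ?_)
  have h1 : 0 ≤ 1 - t := sub_nonneg.2 ht.2
  have h0 := ht.1
  have hi := Finset.mem_range.1 hi
  rw [abs_mul, abs_of_nonneg (by positivity)]
  exact mul_le_mul_of_nonneg_left (he _ (by omega)) (by positivity)

theorem abs_compBernstein_sub_pwLinear_le {n m : ℕ} (hn : 0 < n) (hm : 0 < m) {f g : ℝ → ℝ} {M : ℝ}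
    (hM : ∀ x ∈ Set.Icc (0 : ℝ) 1, |g x - pwLinear m f x| ≤ M)
    (hnode : ∀ j ≤ m, g ((j : ℝ) / m) = pwLinear m f ((j : ℝ) / m))
    {x : ℝ} (hx : x ∈ Set.Icc (0 : ℝ) 1) :
    |compBernstein n m g x - pwLinear m f x| ≤
      (1 - (m * x - (pieceIdx m x - 1)) ^ n - (1 - (m * x - (pieceIdx m x - 1))) ^ n) * M := by
  obtain ⟨hk, hkm, hk₁, hk₂⟩ := pieceIdx_spec hm hx
  unfold compBernstein
  rw [bernsteinPiece_eq hn hm, pwLinear_eq_of_mem hm f hk hkm hk₁ hk₂]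
  generalize pieceIdx m x = k at *
  have hm' : (0 : ℝ) < m := by exact_mod_cast hm
  have hn' : (0 : ℝ) < n := by exact_mod_cast hn
  have hk' : (1 : ℝ) ≤ k := by exact_mod_cast hk
  have hkm' : (k : ℝ) ≤ m := by exact_mod_cast hkm
  have ht : (m : ℝ) * x - (k - 1) ∈ Set.Icc (0 : ℝ) 1 := ⟨by linarith, by linarith⟩
  rw [show (k : ℝ) - m * x = 1 - (m * x - (k - 1)) by ring]
  generalize (m : ℝ) * x - (k - 1) = t at *
  have hcell : ∀ i ≤ n, (0 : ℝ) ≤ (i : ℝ) / n ∧ (i : ℝ) / n ≤ 1 := fun i hi =>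
    ⟨by positivity, (div_le_one hn').2 (by exact_mod_cast hi)⟩
  have hS : ∀ i ≤ n, pwLinear m f ((k - 1 + i / n) / m) =
      f (((k : ℝ) - 1) / m) + (i : ℝ) / n * (f ((k : ℝ) / m) - f (((k : ℝ) - 1) / m)) := by
    intro i hi
    obtain ⟨h0, h1⟩ := hcell i hi
    have hmul : (m : ℝ) * ((k - 1 + i / n) / m) = k - 1 + i / n := by field_simp
    rw [pwLinear_eq_of_mem hm f hk hkm (by linarith) (by linarith), hmul]
    ring
  have key := abs_sum_bernstein_weights_le hn ht
    (e := fun i => g ((k - 1 + i / n) / m) - pwLinear m f ((k - 1 + i / n) / m)) (M := M)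
    (fun i hi => by
      obtain ⟨h0, h1⟩ := hcell i hi
      exact hM _ ⟨div_nonneg (by linarith) hm'.le, (div_le_one hm').2 (by linarith)⟩)
    (by
      have := hnode (k - 1) (by omega)
      rw [Nat.cast_sub hk] at this
      simpa [sub_eq_zero] using this)
    (by simpa [sub_eq_zero, div_self hn'.ne'] using hnode k hkm)
  convert key using 2
  have hlin : ∑ i ∈ Finset.range (n + 1), (n.choose i : ℝ) * t ^ i * (1 - t) ^ (n - i) *
      pwLinear m f ((k - 1 + i / n) / m) =
      (1 - t) * f (((k : ℝ) - 1) / m) + t * f ((k : ℝ) / m) := by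
    calc _ = ∑ i ∈ Finset.range (n + 1),
          ((n.choose i : ℝ) * t ^ i * (1 - t) ^ (n - i) * f (((k : ℝ) - 1) / m) +
            (i : ℝ) * ((n.choose i : ℝ) * t ^ i * (1 - t) ^ (n - i)) *
              ((f ((k : ℝ) / m) - f (((k : ℝ) - 1) / m)) / n)) := by
          refine Finset.sum_congr rfl fun i hi => ?_
          rw [hS i (Nat.lt_succ_iff.1 (Finset.mem_range.1 hi))]
          ring
      _ = _ := by
          rw [Finset.sum_add_distrib, ← Finset.sum_mul, ← Finset.sum_mul,
            sum_bernstein_weights, sum_mul_bernstein_weights]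
          field_simp
          ring
  simp only [mul_sub, Finset.sum_sub_distrib, hlin]

theorem half_pow_le_pow_add_one_sub_pow (n : ℕ) {t : ℝ} (ht : t ∈ Set.Icc (0 : ℝ) 1) :
    (1 / 2 : ℝ) ^ n ≤ t ^ n + (1 - t) ^ n := by
  have h0 := ht.1
  have h1 : 0 ≤ 1 - t := sub_nonneg.2 ht.2
  rcases le_total (1 / 2) t with h | h
  · have := pow_le_pow_left₀ (by norm_num) h n
    linarith [pow_nonneg h1 n]
  · have := pow_le_pow_left₀ (by norm_num) (show (1 / 2 : ℝ) ≤ 1 - t by linarith) n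
    linarith [pow_nonneg h0 n]

theorem abs_iterate_compBernstein_sub_pwLinear_le {n m : ℕ} (hn : 0 < n) (hm : 0 < m) {f : ℝ → ℝ}
    {M : ℝ} (hM : ∀ x ∈ Set.Icc (0 : ℝ) 1, |f x - pwLinear m f x| ≤ M) (r : ℕ) :
    (∀ x ∈ Set.Icc (0 : ℝ) 1,
      |(compBernstein n m)^[r] f x - pwLinear m f x| ≤ (1 - (1 / 2) ^ n) ^ r * M) ∧
    ∀ j ≤ m, (compBernstein n m)^[r] f ((j : ℝ) / m) = pwLinear m f ((j : ℝ) / m) := by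
  induction r with
  | zero => exact ⟨by simpa using hM, fun j hj => (pwLinear_node hm f hj).symm⟩
  | succ r ih =>
    obtain ⟨ihM, ihnode⟩ := ih
    simp only [Function.iterate_succ_apply']
    have hm' : (0 : ℝ) < m := by exact_mod_cast hm
    refine ⟨fun x hx => ?_, fun j hj => ?_⟩
    · obtain ⟨-, -, hk₁, hk₂⟩ := pieceIdx_spec hm hx
      refine (abs_compBernstein_sub_pwLinear_le hn hm ihM ihnode hx).trans ?_
      rw [pow_succ', mul_assoc]
      refine mul_le_mul_of_nonneg_right ?_ ((abs_nonneg _).trans (ihM x hx))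
      have := half_pow_le_pow_add_one_sub_pow n
        (t := (m : ℝ) * x - (pieceIdx m x - 1)) ⟨by linarith, by linarith⟩
      linarith
    · have hx : (j : ℝ) / m ∈ Set.Icc (0 : ℝ) 1 :=
        ⟨by positivity, (div_le_one hm').2 (by exact_mod_cast hj)⟩
      obtain ⟨-, -, hk₁, hk₂⟩ := pieceIdx_spec hm hx
      have h := abs_compBernstein_sub_pwLinear_le hn hm ihM ihnode hx
      rw [show (m : ℝ) * (j / m) = j by field_simp] at h hk₁ hk₂
      have hk : pieceIdx m ((j : ℝ) / m) ≤ j + 1 := by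
        have : (pieceIdx m ((j : ℝ) / m) : ℝ) ≤ j + 1 := by linarith
        exact_mod_cast this
      have hj' : j ≤ pieceIdx m ((j : ℝ) / m) := by exact_mod_cast hk₂
      rw [← sub_eq_zero, ← abs_nonpos_iff]
      refine h.trans_eq ?_
      rcases (show pieceIdx m ((j : ℝ) / m) = j ∨ pieceIdx m ((j : ℝ) / m) = j + 1 by omega)
        with e | e <;> simp [e, hn.ne']

theorem exists_abs_sub_pwLinear_le {m : ℕ} (hm : 0 < m) {f : ℝ → ℝ}
    (hf : ContinuousOn f (Set.Icc 0 1)) :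
    ∃ M, ∀ x ∈ Set.Icc (0 : ℝ) 1, |f x - pwLinear m f x| ≤ M := by
  obtain ⟨C, hC⟩ := isCompact_Icc.exists_bound_of_continuousOn hf
  refine ⟨C + C, fun x hx => ?_⟩
  have hm' : (0 : ℝ) < m := by exact_mod_cast hm
  obtain ⟨hk, hkm, hk₁, hk₂⟩ := pieceIdx_spec hm hx
  have hk' : (1 : ℝ) ≤ pieceIdx m x := by exact_mod_cast hk
  have hkm' : (pieceIdx m x : ℝ) ≤ m := by exact_mod_cast hkm
  have ha := hC (((pieceIdx m x : ℝ) - 1) / m)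
    ⟨div_nonneg (by linarith) hm'.le, (div_le_one hm').2 (by linarith)⟩
  have hb := hC ((pieceIdx m x : ℝ) / m) ⟨by positivity, (div_le_one hm').2 hkm'⟩
  have hfx := hC x hx
  rw [pwLinear_eq_of_mem hm f hk hkm hk₁ hk₂]
  rw [Real.norm_eq_abs, abs_le] at ha hb hfx
  rw [abs_le]
  constructor <;> nlinarith

theorem compBernstein_iterates_tendsto
    (n m : ℕ) (hn : 2 ≤ n) (hm : 0 < m)
    (f : ℝ → ℝ) (hf : ContinuousOn f (Set.Icc 0 1)) :
    TendstoUniformlyOn (fun r x => (compBernstein n m)^[r] f x) (pwLinear m f)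
      Filter.atTop (Set.Icc (0 : ℝ) 1) := by
  obtain ⟨M, hM⟩ := exists_abs_sub_pwLinear_le hm hf
  have hpos : (0 : ℝ) < (1 / 2) ^ n := by positivity
  have hle : (1 / 2 : ℝ) ^ n ≤ 1 := pow_le_one₀ (by norm_num) (by norm_num)
  have hlim : Filter.Tendsto (fun r : ℕ => (1 - (1 / 2 : ℝ) ^ n) ^ r * M) Filter.atTop (nhds 0) := by
    simpa using (tendsto_pow_atTop_nhds_zero_of_lt_one (sub_nonneg.2 hle)
      (sub_lt_self 1 hpos)).mul_const M
  rw [Metric.tendstoUniformlyOn_iff]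
  intro ε hε
  filter_upwards [hlim.eventually_lt_const hε] with r hr x hx
  rw [dist_comm, Real.dist_eq]
  exact ((abs_iterate_compBernstein_sub_pwLinear_le (by omega) hm hM r).1 x hx).trans_lt hr
end
end
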